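/- Under the positive-unlabeled learning setup, for every z ∈ (0,1] the high-noise region satisfies 𝒫(B_z) ≤ (ρ/(1−ρ))·((1−z)/z); consequently also Q(B_z) ≤ (ρ/(1−ρ))·((1−z)/z). -/

import Mathlib

open MeasureTheory Set
open scoped ProbabilityTheory ENNReal symmDiff

noncomputable section

/-- The noise rate `γ(x) = ρ·u(x)/(ρ·u(x) + (1−ρ)·p(x))` for `x ∈ P`, and `0` otherwise
(note that in `ℝ≥0∞` the quotient `0/0` is `0`, so the convention for a vanishing
denominator is automatic since `ρ > 0` forces the numerator to vanish as well). -/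
noncomputable def noiseRate {d : ℕ} (P : Set (EuclideanSpace ℝ (Fin d))) (ρ : ℝ)
    (p u : EuclideanSpace ℝ (Fin d) → ℝ≥0∞) (x : EuclideanSpace ℝ (Fin d)) : ℝ≥0∞ :=
  P.indicator
    (fun x => (ENNReal.ofReal ρ * u x) /
      (ENNReal.ofReal ρ * u x + ENNReal.ofReal (1 - ρ) * p x)) x

/-- The high-noise region `B_z = {x ∈ P : γ(x) ≥ z}`. -/
noncomputable def highNoise {d : ℕ} (P : Set (EuclideanSpace ℝ (Fin d))) (ρ : ℝ)
    (p u : EuclideanSpace ℝ (Fin d) → ℝ≥0∞) (z : ℝ) : Set (EuclideanSpace ℝ (Fin d)) :=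
  {x ∈ P | ENNReal.ofReal z ≤ noiseRate P ρ p u x}

/-- The classification error `Err(S) = ρ·U(S) + (1−ρ)·𝒫(ℝ^d ∖ S)`. -/
noncomputable def classErr {d : ℕ} (U Pm : Measure (EuclideanSpace ℝ (Fin d))) (ρ : ℝ)
    (S : Set (EuclideanSpace ℝ (Fin d))) : ℝ :=
  ρ * (U S).toReal + (1 - ρ) * (Pm Sᶜ).toReal

theorem measurableSet_highNoise {d : ℕ} {P : Set (EuclideanSpace ℝ (Fin d))}
    (hP : MeasurableSet P) {p u : EuclideanSpace ℝ (Fin d) → ℝ≥0∞} (hp : Measurable p)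
    (hu : Measurable u) (ρ z : ℝ) : MeasurableSet (highNoise P ρ p u z) := by
  have hγ : Measurable (noiseRate P ρ p u) :=
    Measurable.indicator (by fun_prop) hP
  exact hP.inter (measurableSet_le measurable_const hγ)

/-- On the high-noise region the positive density is controlled by the unlabeled one. -/
theorem density_le_of_mem_highNoise {d : ℕ} {P : Set (EuclideanSpace ℝ (Fin d))}
    {p u : EuclideanSpace ℝ (Fin d) → ℝ≥0∞} {ρ z : ℝ} (hρ : ρ ∈ Set.Ioo (0 : ℝ) 1)
    (hz : z ∈ Set.Ioc (0 : ℝ) 1) {x : EuclideanSpace ℝ (Fin d)}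
    (hx : x ∈ highNoise P ρ p u z) (hpx : p x ≠ ∞) (hux : u x ≠ ∞) :
    p x ≤ ENNReal.ofReal (ρ / (1 - ρ) * ((1 - z) / z)) * u x := by
  obtain ⟨hρ0, hρ1⟩ := hρ
  obtain ⟨hz0, hz1⟩ := hz
  have h1ρ : 0 < 1 - ρ := sub_pos.2 hρ1
  have h1z : 0 ≤ 1 - z := sub_nonneg.2 hz1
  obtain ⟨hxP, hzx⟩ := hx
  rw [noiseRate, indicator_of_mem hxP] at hzx
  replace hzx := ENNReal.mul_le_of_le_div hzx
  rw [← ENNReal.ofReal_toReal hpx, ← ENNReal.ofReal_toReal hux] at hzx ⊢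
  have hp0 : 0 ≤ (p x).toReal := ENNReal.toReal_nonneg
  have hu0 : 0 ≤ (u x).toReal := ENNReal.toReal_nonneg
  rw [← ENNReal.ofReal_mul hρ0.le, ← ENNReal.ofReal_mul h1ρ.le,
    ← ENNReal.ofReal_add (by positivity) (by positivity), ← ENNReal.ofReal_mul hz0.le,
    ENNReal.ofReal_le_ofReal_iff (by positivity)] at hzx
  rw [← ENNReal.ofReal_mul (by positivity)]
  refine ENNReal.ofReal_le_ofReal ?_
  have heq : ρ / (1 - ρ) * ((1 - z) / z) * (u x).toReal =
      ρ * (1 - z) * (u x).toReal / ((1 - ρ) * z) := by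
    field_simp
  rw [heq, le_div_iff₀ (by positivity)]
  linarith

theorem stmt2 {d : ℕ}
    (Q U ν : Measure (EuclideanSpace ℝ (Fin d)))
    [IsProbabilityMeasure Q] [IsProbabilityMeasure U] [SigmaFinite ν]
    (P : Set (EuclideanSpace ℝ (Fin d))) (hP : MeasurableSet P) (hQP : 0 < Q P)
    (p u : EuclideanSpace ℝ (Fin d) → ℝ≥0∞) (hp : Measurable p) (hu : Measurable u)
    (hPdens : Q[|P] = ν.withDensity p)
    (hUdens : U = ν.withDensity u)
    (hpP : ∀ᵐ x ∂ν, x ∉ P → p x = 0)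
    (ρ : ℝ) (hρ : ρ ∈ Set.Ioo (0 : ℝ) 1)
    (z : ℝ) (hz : z ∈ Set.Ioc (0 : ℝ) 1) :
    (Q[|P] (highNoise P ρ p u z)).toReal ≤ ρ / (1 - ρ) * ((1 - z) / z) ∧
      (Q (highNoise P ρ p u z)).toReal ≤ ρ / (1 - ρ) * ((1 - z) / z) := by
  set B := highNoise P ρ p u z with hB
  have hBm : MeasurableSet B := measurableSet_highNoise hP hp hu ρ z
  have hc : 0 ≤ ρ / (1 - ρ) * ((1 - z) / z) :=
    mul_nonneg (div_nonneg hρ.1.le (sub_nonneg.2 hρ.2.le))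
      (div_nonneg (sub_nonneg.2 hz.2) hz.1.le)
  have hp_fin : ∀ᵐ x ∂ν, p x < ∞ := by
    refine ae_lt_top hp ?_
    rw [← setLIntegral_univ, ← withDensity_apply _ MeasurableSet.univ, ← hPdens]
    exact measure_ne_top _ _
  have hu_fin : ∀ᵐ x ∂ν, u x < ∞ := by
    refine ae_lt_top hu ?_
    rw [← setLIntegral_univ, ← withDensity_apply _ MeasurableSet.univ, ← hUdens]
    exact measure_ne_top _ _
  have hcond : Q[|P] B ≤ ENNReal.ofReal (ρ / (1 - ρ) * ((1 - z) / z)) := by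
    calc Q[|P] B = ∫⁻ x in B, p x ∂ν := by rw [hPdens, withDensity_apply _ hBm]
      _ ≤ ∫⁻ x in B, ENNReal.ofReal (ρ / (1 - ρ) * ((1 - z) / z)) * u x ∂ν := by
        refine setLIntegral_mono_ae (by fun_prop) ?_
        filter_upwards [hp_fin, hu_fin] with x hpx hux hx
        exact density_le_of_mem_highNoise hρ hz hx hpx.ne hux.ne
      _ = ENNReal.ofReal (ρ / (1 - ρ) * ((1 - z) / z)) * U B := by
        rw [lintegral_const_mul _ hu, hUdens, withDensity_apply _ hBm]
      _ ≤ ENNReal.ofReal (ρ / (1 - ρ) * ((1 - z) / z)) := mul_le_of_le_one_right' prob_le_one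
  have hQ : Q B ≤ Q[|P] B := by
    have hBP : P ∩ B = B := inter_eq_right.2 fun x hx => hx.1
    rw [ProbabilityTheory.cond_apply hP, hBP]
    exact le_mul_of_one_le_left' (ENNReal.one_le_inv.2 prob_le_one)
  exact ⟨ENNReal.toReal_le_of_le_ofReal hc hcond,
    ENNReal.toReal_le_of_le_ofReal hc (hQ.trans hcond)⟩
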